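/- Let u be an arbitrary word and v, w nonempty words over V. Then u ≻ (vw) = Σ_{u=u¹u²} (u¹ ≻ v)(u² ≻ w), where vw and the juxtaposition on the right denote concatenation and the sum runs over all cuts of u (with the empty-word conventions for the operations). -/

import Mathlib

open Finset MonoidAlgebra TensorProduct

/-- `Sh(p,q)`: permutations of the `p+q` indices that are increasing on the
first `p` indices and on the last `q` indices. -/
def IsSh (p q : ℕ) (σ : Equiv.Perm (Fin (p + q))) : Prop :=
  (∀ i j : Fin (p + q), (i : ℕ) < (j : ℕ) → (j : ℕ) < p → σ i < σ j) ∧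
  (∀ i j : Fin (p + q), p ≤ (i : ℕ) → (i : ℕ) < (j : ℕ) → σ i < σ j)

instance IsSh.decPred (p q : ℕ) : DecidablePred (IsSh p q) := fun _ => by
  unfold IsSh; infer_instance

/-- The word `u_{σ⁻¹(1)} u_{σ⁻¹(2)} ⋯ u_{σ⁻¹(p+q)}` where `u₁ ⋯ u_p` is `u` and
`u_{p+1} ⋯ u_{p+q}` is `v`. -/
def shWord {V : Type*} (u v : List V) (σ : Equiv.Perm (Fin (u.length + v.length))) :
    FreeMonoid V :=
  FreeMonoid.ofList
    (List.ofFn fun i => (u ++ v).get (Fin.cast (List.length_append (as := u) (bs := v)).symm (σ.symm i)))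

/-- `posCond p b i` says that the letter at (combined) index `i` comes from the second
word (`b = true`, i.e. `p ≤ i`) or from the first word (`b = false`, i.e. `i < p`). -/
def posCond (p : ℕ) (b : Bool) (i : ℕ) : Prop :=
  match b with
  | true => p ≤ i
  | false => i < p

instance posCond.dec (p : ℕ) (b : Bool) (i : ℕ) : Decidable (posCond p b i) := by
  cases b <;> unfold posCond <;> infer_instance

variable (k : Type*) [CommRing k] {V : Type*}

/-- The shuffle product `u ⧢ v` of two words, as an element of the monoid algebra
`H` of the free monoid on `V` (sum over all `(p,q)`-shuffles); in particular
`1 ⧢ a = a ⧢ 1 = a`. -/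
noncomputable def shuffleProd (u v : List V) : MonoidAlgebra k (FreeMonoid V) :=
  ∑ σ ∈ univ.filter (IsSh u.length v.length),
    MonoidAlgebra.single (shWord u v σ) (1 : k)

/-- Generic quadri-algebra operation on words: the part of the shuffle product `u ⧢ v`
consisting of the shuffles where the first (resp. last) letter comes from `v` iff `fb`
(resp. `lb`) is `true`.  (For a shuffle permutation, the first letter comes from `v`
iff `σ⁻¹(1) = p+1`, and from `u` iff `σ⁻¹(1) = 1`; the last letter comes from `v` iff
`σ⁻¹(p+q) = p+q`, and from `u` iff `σ⁻¹(p+q) = p`.)  This definition also encodes the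
empty-word conventions: `1 ↘ a = a` and `a ↖ 1 = a` for nonempty `a`, and all other
quadri-algebra operations with an empty argument are `0`. -/
noncomputable def quadOp (fb lb : Bool) (u v : List V) : MonoidAlgebra k (FreeMonoid V) :=
  ∑ σ ∈ univ.filter (fun σ : Equiv.Perm (Fin (u.length + v.length)) =>
      IsSh u.length v.length σ ∧
      ∃ h : 0 < u.length + v.length,
        posCond u.length fb (σ.symm ⟨0, h⟩) ∧
        posCond u.length lb (σ.symm ⟨u.length + v.length - 1, Nat.sub_lt h Nat.one_pos⟩)),
    MonoidAlgebra.single (shWord u v σ) (1 : k)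

/-- `u ↘ v` : shuffles whose first and last letters come from `v`. -/
noncomputable def seOp (u v : List V) : MonoidAlgebra k (FreeMonoid V) := quadOp k true true u v

/-- `u ↗ v` : shuffles whose first letter comes from `v` and last letter from `u`. -/
noncomputable def neOp (u v : List V) : MonoidAlgebra k (FreeMonoid V) := quadOp k true false u v

/-- `u ↖ v` : shuffles whose first and last letters come from `u`. -/
noncomputable def nwOp (u v : List V) : MonoidAlgebra k (FreeMonoid V) := quadOp k false false u v

/-- `u ↙ v` : shuffles whose first letter comes from `u` and last letter from `v`. -/
noncomputable def swOp (u v : List V) : MonoidAlgebra k (FreeMonoid V) := quadOp k false true u v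

/-- `u ≻ v := u ↗ v + u ↘ v`. -/
noncomputable def succOp (u v : List V) : MonoidAlgebra k (FreeMonoid V) := neOp k u v + seOp k u v

/-- `u ≺ v := u ↖ v + u ↙ v`. -/
noncomputable def precOp (u v : List V) : MonoidAlgebra k (FreeMonoid V) := nwOp k u v + swOp k u v

/-- `u ∨ v := u ↘ v + u ↙ v`. -/
noncomputable def veeOp (u v : List V) : MonoidAlgebra k (FreeMonoid V) := seOp k u v + swOp k u v

/-- `u ∧ v := u ↗ v + u ↖ v`. -/
noncomputable def wedgeOp (u v : List V) : MonoidAlgebra k (FreeMonoid V) := neOp k u v + nwOp k u v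

/-- Shuffle condition, phrased on the inverse permutation. -/
def ShCond (n p : ℕ) (τ : Equiv.Perm (Fin n)) : Prop :=
  ∀ i j : Fin n, i < j → τ j < τ i → ((τ j : ℕ) < p ∧ p ≤ (τ i : ℕ))

open Classical in
/-- The sum over shuffles, with a predicate on the permutation. -/
noncomputable def shSum (n p : ℕ) (x : Fin n → V) : MonoidAlgebra k (FreeMonoid V) :=
  ∑ τ ∈ univ.filter (ShCond n p),
    MonoidAlgebra.single (FreeMonoid.ofList (List.ofFn fun i => x (τ i))) (1 : k)

/-- Extend a permutation by sending `0` to `m`. -/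
def extPerm {n : ℕ} (m : Fin (n + 1)) (τ : Equiv.Perm (Fin n)) : Equiv.Perm (Fin (n + 1)) :=
  ((finSuccEquiv' 0).trans (Equiv.optionCongr τ)).trans (finSuccEquiv' m).symm

theorem extPerm_zero {n : ℕ} (m : Fin (n + 1)) (τ : Equiv.Perm (Fin n)) :
    extPerm m τ 0 = m := by
  simp [extPerm]

theorem extPerm_succ {n : ℕ} (m : Fin (n + 1)) (τ : Equiv.Perm (Fin n)) (i : Fin n) :
    extPerm m τ i.succ = m.succAbove (τ i) := by
  have : finSuccEquiv' (0 : Fin (n+1)) i.succ = some i := by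
    rw [← Fin.succAbove_zero, finSuccEquiv'_succAbove]
  simp [extPerm, this]

theorem extPerm_inj {n : ℕ} (m : Fin (n + 1)) {τ τ' : Equiv.Perm (Fin n)}
    (h : extPerm m τ = extPerm m τ') : τ = τ' := by
  ext i : 1
  have := congrArg (fun e => e i.succ) h
  simp only [extPerm_succ] at this
  exact Fin.succAbove_right_injective this

theorem extPerm_surj {n : ℕ} (m : Fin (n + 1)) (σ : Equiv.Perm (Fin (n + 1))) (h : σ 0 = m) :
    ∃ τ, extPerm m τ = σ := by
  have key : ∀ i : Fin n, ∃ j : Fin n, m.succAbove j = σ i.succ := by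
    intro i
    apply Fin.exists_succAbove_eq
    rw [← h]
    intro h2
    exact Fin.succ_ne_zero i (σ.injective h2)
  choose f hf using key
  have finj : Function.Injective f := by
    intro a b hab
    have : σ a.succ = σ b.succ := by rw [← hf, ← hf, hab]
    exact Fin.succ_injective _ (σ.injective this)
  refine ⟨Equiv.ofBijective f (Finite.injective_iff_bijective.mp finj), ?_⟩
  ext i : 1
  refine Fin.cases ?_ (fun i => ?_) i
  · rw [extPerm_zero, h]
  · rw [extPerm_succ]; simpa using hf i

theorem shCond_ext {n : ℕ} (p : ℕ) (m : Fin (n + 1)) (τ : Equiv.Perm (Fin n)) :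
    ShCond (n + 1) p (extPerm m τ) ↔
      (∀ j : Fin n, m.succAbove (τ j) < m → ((m.succAbove (τ j) : ℕ) < p ∧ p ≤ (m : ℕ))) ∧
      (∀ i j : Fin n, i < j → τ j < τ i →
        ((m.succAbove (τ j) : ℕ) < p ∧ p ≤ (m.succAbove (τ i) : ℕ))) := by
  constructor
  · intro h
    refine ⟨fun j hj => ?_, fun i j hij hj => ?_⟩
    · have := h 0 j.succ (Fin.succ_pos j)
      rw [extPerm_zero, extPerm_succ] at this
      exact this hj
    · have := h i.succ j.succ (Fin.succ_lt_succ_iff.mpr hij)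
      rw [extPerm_succ, extPerm_succ, Fin.succAbove_lt_succAbove_iff] at this
      exact this hj
  · rintro ⟨h1, h2⟩ i j
    refine Fin.cases ?_ (fun i => ?_) i <;> refine Fin.cases ?_ (fun j => ?_) j
    · intro h; exact absurd h (lt_irrefl _)
    · intro _; rw [extPerm_zero, extPerm_succ]; exact h1 j
    · intro h; exact absurd h (Fin.not_lt_zero _)
    · intro h
      rw [extPerm_succ, extPerm_succ, Fin.succAbove_lt_succAbove_iff]
      exact h2 i j (Fin.succ_lt_succ_iff.mp h)

theorem shCond_ext_zero {n : ℕ} (p : ℕ) (τ : Equiv.Perm (Fin n)) :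
    ShCond (n + 1) p (extPerm 0 τ) ↔ ShCond n (p - 1) τ := by
  rw [shCond_ext]
  constructor
  · rintro ⟨_, h⟩ i j hij hj
    have := h i j hij hj
    simp only [Fin.succAbove_zero, Fin.val_succ] at this
    omega
  · intro h
    refine ⟨fun j hj => absurd hj (Fin.not_lt_zero _), fun i j hij hj => ?_⟩
    have := h i j hij hj
    simp only [Fin.succAbove_zero, Fin.val_succ]
    omega

theorem succAbove_val {n : ℕ} (m : Fin (n + 1)) (i : Fin n) :
    (m.succAbove i : ℕ) = if (i : ℕ) < m then (i : ℕ) else i + 1 := by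
  unfold Fin.succAbove
  simp only [Fin.lt_def, Fin.val_castSucc]
  split_ifs <;> simp

theorem shCond_ext_p {n : ℕ} (m : Fin (n + 1)) (τ : Equiv.Perm (Fin n)) :
    ShCond (n + 1) m (extPerm m τ) ↔ ShCond n m τ := by
  rw [shCond_ext]
  constructor
  · rintro ⟨_, h⟩ i j hij hj
    have := h i j hij hj
    simp only [succAbove_val] at this
    split_ifs at this <;> omega
  · intro h
    refine ⟨fun j hj => ⟨hj, le_refl _⟩, fun i j hij hj => ?_⟩
    have := h i j hij hj
    simp only [succAbove_val]
    split_ifs <;> omega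

theorem shCond_first {n p : ℕ} (σ : Equiv.Perm (Fin (n + 1))) (h : ShCond (n + 1) p σ) :
    (σ 0 : ℕ) = 0 ∨ (σ 0 : ℕ) = p := by
  by_contra! hc
  have aux : ∀ a : Fin (n + 1), a < σ 0 → ((a : ℕ) < p ∧ p ≤ (σ 0 : ℕ)) := by
    intro a ha
    have := h 0 (σ.symm a) ?_ (by simpa using ha)
    · simpa using this
    · rw [Fin.pos_iff_ne_zero]
      intro h0
      have : a = σ 0 := by rw [← h0]; simp
      exact absurd ha (by rw [this]; exact lt_irrefl _)
  have h0 := aux 0 (Fin.lt_def.mpr (by simp only [Fin.val_zero]; omega))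
  have h1 := aux ⟨p, by have := (σ 0).isLt; omega⟩ (Fin.lt_def.mpr (by simp only; omega))
  simp at h1

open Classical in
theorem sum_first {n p p' : ℕ} (m : Fin (n + 1)) (x : Fin (n + 1) → V)
    (hm : ∀ τ, ShCond (n + 1) p (extPerm m τ) ↔ ShCond n p' τ) :
    ∑ τ ∈ univ.filter (fun τ => ShCond (n + 1) p τ ∧ τ 0 = m),
      MonoidAlgebra.single (FreeMonoid.ofList (List.ofFn fun i => x (τ i))) (1 : k) =
    MonoidAlgebra.single (FreeMonoid.ofList [x m]) (1 : k) *
      shSum k n p' (fun i => x (m.succAbove i)) := by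
  unfold shSum
  rw [Finset.mul_sum]
  symm
  refine Finset.sum_bij (fun τ _ => extPerm m τ) ?_ ?_ ?_ ?_
  · intro τ hτ
    simp only [mem_filter, mem_univ, true_and] at hτ ⊢
    exact ⟨(hm τ).mpr hτ, extPerm_zero m τ⟩
  · intro a _ b _ h; exact extPerm_inj m h
  · intro σ hσ
    simp only [mem_filter, mem_univ, true_and] at hσ
    obtain ⟨τ, rfl⟩ := extPerm_surj m σ hσ.2
    refine ⟨τ, ?_, rfl⟩
    simpa using (hm τ).mp hσ.1
  · intro τ _
    rw [MonoidAlgebra.single_mul_single, one_mul, ← FreeMonoid.ofList_append]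
    simp [List.ofFn_succ, extPerm_zero, extPerm_succ]

theorem shSum_succ_zero {n : ℕ} (x : Fin (n + 1) → V) :
    shSum k (n + 1) 0 x = MonoidAlgebra.single (FreeMonoid.ofList [x 0]) (1 : k) *
      shSum k n 0 (fun i => x i.succ) := by
  classical
  have := sum_first k (p := 0) (p' := 0) 0 x (fun τ => shCond_ext_zero 0 τ)
  simp only [Fin.succAbove_zero] at this
  rw [← this]
  unfold shSum
  refine Finset.sum_congr ?_ (fun _ _ => rfl)
  ext σ
  simp only [mem_filter, mem_univ, true_and]
  refine ⟨fun h => ⟨h, ?_⟩, fun h => h.1⟩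
  have := shCond_first σ h
  ext; simpa using this

theorem shSum_succ_last {n : ℕ} (x : Fin (n + 1) → V) :
    shSum k (n + 1) (n + 1) x = MonoidAlgebra.single (FreeMonoid.ofList [x 0]) (1 : k) *
      shSum k n n (fun i => x i.succ) := by
  classical
  have := sum_first k (p := n + 1) (p' := n) 0 x (fun τ => shCond_ext_zero (n + 1) τ)
  simp only [Fin.succAbove_zero] at this
  rw [← this]
  unfold shSum
  refine Finset.sum_congr ?_ (fun _ _ => rfl)
  ext σ
  simp only [mem_filter, mem_univ, true_and]
  refine ⟨fun h => ⟨h, ?_⟩, fun h => h.1⟩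
  have := shCond_first σ h
  have h2 := (σ 0).isLt
  ext; simp only [Fin.val_zero]; omega

theorem shSum_succ_mid {n : ℕ} (m : Fin (n + 1)) (hm : m ≠ 0) (x : Fin (n + 1) → V) :
    shSum k (n + 1) m x =
      MonoidAlgebra.single (FreeMonoid.ofList [x 0]) (1 : k) *
        shSum k n (m - 1) (fun i => x i.succ) +
      MonoidAlgebra.single (FreeMonoid.ofList [x m]) (1 : k) *
        shSum k n m (fun i => x (m.succAbove i)) := by
  classical
  have h1 := sum_first k (p := m) (p' := m - 1) 0 x (fun τ => shCond_ext_zero m τ)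
  have h2 := sum_first k (p := m) (p' := m) m x (fun τ => shCond_ext_p m τ)
  simp only [Fin.succAbove_zero] at h1
  rw [← h1, ← h2, ← Finset.sum_union]
  · unfold shSum
    refine Finset.sum_congr ?_ (fun _ _ => rfl)
    ext σ
    simp only [mem_filter, mem_univ, true_and, mem_union]
    constructor
    · intro h
      rcases shCond_first σ h with h' | h'
      · exact Or.inl ⟨h, by ext; simpa using h'⟩
      · exact Or.inr ⟨h, by ext; simpa using h'⟩
    · rintro (h | h) <;> exact h.1
  · rw [Finset.disjoint_left]
    intro σ h1 h2
    simp only [mem_filter, mem_univ, true_and] at h1 h2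
    exact hm (h2.2.symm.trans h1.2)

/-- Recursive shuffle product. -/
noncomputable def recSh : List V → List V → MonoidAlgebra k (FreeMonoid V)
  | [], v => MonoidAlgebra.single (FreeMonoid.ofList v) 1
  | a :: u, [] => MonoidAlgebra.single (FreeMonoid.ofList (a :: u)) 1
  | a :: u, b :: v =>
    MonoidAlgebra.single (FreeMonoid.ofList [a]) 1 * recSh u (b :: v) +
      MonoidAlgebra.single (FreeMonoid.ofList [b]) 1 * recSh (a :: u) v
termination_by u v => u.length + v.length

theorem recSh_cons (a b : V) (u v : List V) : recSh k (a :: u) (b :: v) =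
    MonoidAlgebra.single (FreeMonoid.ofList [a]) 1 * recSh k u (b :: v) +
      MonoidAlgebra.single (FreeMonoid.ofList [b]) 1 * recSh k (a :: u) v := by
  rw [recSh]

theorem recSh_nil (u : List V) :
    recSh k u [] = MonoidAlgebra.single (FreeMonoid.ofList u) 1 := by
  cases u <;> rw [recSh]

theorem single_cons (a : V) (u : List V) :
    MonoidAlgebra.single (FreeMonoid.ofList (a :: u)) (1 : k) =
    MonoidAlgebra.single (FreeMonoid.ofList [a]) 1 *
      MonoidAlgebra.single (FreeMonoid.ofList u) 1 := by
  rw [MonoidAlgebra.single_mul_single, one_mul, ← FreeMonoid.ofList_append]; rfl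

theorem shSum_eq_recSh (n : ℕ) : ∀ (u v : List V) (x : Fin n → V), u.length + v.length = n →
    (∀ i : Fin n, (u ++ v)[(i : ℕ)]? = some (x i)) → shSum k n u.length x = recSh k u v := by
  induction n with
  | zero =>
    intro u v x h _
    obtain rfl : u = [] := List.length_eq_zero_iff.mp (by omega)
    obtain rfl : v = [] := List.length_eq_zero_iff.mp (by omega)
    classical
    rw [recSh, shSum, Finset.filter_true_of_mem (fun σ _ i => i.elim0)]
    simp
  | succ n ih =>
    intro u v x h hx
    have hx0 := hx 0
    match u, v with
    | [], [] => simp at h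
    | [], b :: v =>
      have e := ih [] v (fun i => x i.succ) (by simp at h ⊢; omega)
        (fun i => by simpa using hx i.succ)
      simp only [List.length_nil] at e ⊢
      rw [shSum_succ_zero, e, recSh, recSh, single_cons k b v]
      simp at hx0
      rw [hx0]
    | a :: u, [] =>
      have hn : u.length = n := by simpa using h
      have e := ih u [] (fun i => x i.succ) (by simpa using hn)
        (fun i => by simpa using hx i.succ)
      have hl : (a :: u).length = n + 1 := by simp [hn]
      rw [hl, shSum_succ_last]
      rw [hn] at e
      rw [e, recSh_nil, recSh_nil, single_cons k a u]
      simp at hx0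
      rw [hx0]
    | a :: u, b :: v =>
      have hn : u.length + 1 + v.length = n := by simp at h; omega
      let m : Fin (n + 1) := ⟨(a :: u).length, by simp; omega⟩
      have e := shSum_succ_mid k m (by simp [m, Fin.ext_iff]) x
      have e1 := ih u (b :: v) (fun i => x i.succ) (by simp; omega)
        (fun i => by simpa using hx i.succ)
      have e2 := ih (a :: u) v (fun i => x (m.succAbove i)) (by simp; omega) ?_
      · have hm : (m : ℕ) = (a :: u).length := rfl
        have hm' : (m : ℕ) - 1 = u.length := by simp [m]
        rw [hm', e1, hm, e2] at e
        rw [e, recSh]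
        have hxm := hx m
        rw [hm, List.getElem?_append_right (le_refl _)] at hxm
        simp at hx0 hxm
        rw [← hx0, ← hxm]
      · intro i
        rw [← hx, succAbove_val]
        simp only [m]
        split_ifs with hi
        · rw [List.getElem?_append_left hi, List.getElem?_append_left hi]
        · rw [List.getElem?_append_right (by omega), List.getElem?_append_right (by omega)]
          have : (i : ℕ) + 1 - (a :: u).length = (i - (a :: u).length) + 1 := by omega
          rw [this, List.getElem?_cons_succ]

theorem isSh_iff (p q : ℕ) (σ : Equiv.Perm (Fin (p + q))) :
    IsSh p q σ ↔ ShCond (p + q) p σ.symm := by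
  constructor
  · rintro ⟨h1, h2⟩ i j hij hj
    by_contra hc
    by_cases hp : (σ.symm i : ℕ) < p
    · have := h1 _ _ hj hp
      simp at this
      exact absurd hij (not_lt.mpr this.le)
    · have := h2 _ _ (by omega) hj
      simp at this
      exact absurd hij (not_lt.mpr this.le)
  · intro h
    have aux : ∀ i j : Fin (p + q), i < j → ¬ ((i : ℕ) < p ∧ p ≤ (j : ℕ)) → σ i < σ j := by
      intro i j hij hc
      by_contra hn
      have hne : σ i ≠ σ j := fun e => hij.ne (σ.injective e)
      have hlt : σ j < σ i := lt_of_le_of_ne (not_lt.mp hn) hne.symm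
      have := h (σ j) (σ i) hlt (by simpa using hij)
      simp at this
      exact hc this
    exact ⟨fun i j hij hj => aux i j hij (by omega), fun i j hi hij => aux i j hij (by omega)⟩

theorem succOp_cons (u : List V) (b : V) (v : List V) :
    succOp k u (b :: v) =
      MonoidAlgebra.single (FreeMonoid.ofList [b]) (1 : k) * recSh k u v := by
  classical
  have hlt : u.length < u.length + v.length + 1 := by omega
  let m : Fin (u.length + v.length + 1) := ⟨u.length, hlt⟩
  let x : Fin (u.length + v.length + 1) → V := fun i => (u ++ b :: v).get
    (Fin.cast (by simp; omega) i)
  have h2 := sum_first k (p := m) (p' := m) m x (fun τ => shCond_ext_p m τ)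
  have e2 := shSum_eq_recSh k _ u v (fun i => x (m.succAbove i)) rfl ?_
  · have hxm : x m = b := by simp [x, m]
    rw [hxm] at h2
    simp only [m] at h2 e2
    rw [e2] at h2
    rw [← h2]
    unfold succOp neOp seOp quadOp
    rw [← Finset.sum_union]
    · refine Finset.sum_bij (fun σ _ => σ.symm) ?_ ?_ ?_ ?_
      · intro σ hσ
        simp only [mem_filter, mem_univ, true_and, mem_union, isSh_iff, posCond] at hσ ⊢
        have h1 : ShCond (u.length + v.length + 1) u.length σ.symm := by
          rcases hσ with h | h <;> exact h.1
        refine ⟨h1, ?_⟩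
        have h3 : u.length ≤ (σ.symm (0 : Fin (u.length + v.length + 1)) : ℕ) := by
          rcases hσ with ⟨_, _, h, _⟩ | ⟨_, _, h, _⟩ <;> exact h
        have := shCond_first _ h1
        apply Fin.ext
        show (σ.symm (0 : Fin (u.length + v.length + 1)) : ℕ) = u.length
        omega
      · intro a _ c _ h; exact Equiv.symm_bijective.injective h
      · intro τ hτ
        simp only [mem_filter, mem_univ, true_and] at hτ
        refine ⟨τ.symm, ?_, rfl⟩
        have h0 : u.length ≤ (τ 0 : ℕ) := by rw [hτ.2]
        simp only [mem_filter, mem_univ, true_and, mem_union, isSh_iff, posCond]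
        by_cases hl : (τ (Fin.last _) : ℕ) < u.length
        · exact Or.inl ⟨hτ.1, by simp, h0, hl⟩
        · exact Or.inr ⟨hτ.1, by simp, h0, not_lt.mp hl⟩
      · intro σ _
        rfl
    · rw [Finset.disjoint_left]
      intro σ h1 h2
      obtain ⟨_, _, _, h1⟩ := (Finset.mem_filter.mp h1).2
      obtain ⟨_, _, _, h2⟩ := (Finset.mem_filter.mp h2).2
      exact absurd h1 (not_lt.mpr h2)
  · intro i
    have hx : ∀ j : Fin (u.length + v.length + 1), (u ++ b :: v)[(j : ℕ)]? = some (x j) := by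
      intro j
      simp only [x, List.get_eq_getElem, Fin.val_cast]
      rw [List.getElem?_eq_getElem]
    rw [← hx, succAbove_val]
    simp only [m]
    split_ifs with hi
    · rw [List.getElem?_append_left hi, List.getElem?_append_left hi]
    · rw [List.getElem?_append_right (by omega), List.getElem?_append_right (by omega)]
      have : (i : ℕ) + 1 - u.length = (i - u.length) + 1 := by omega
      rw [this, List.getElem?_cons_succ]

theorem recSh_append (c : V) (w : List V) : ∀ (u v : List V),
    recSh k u (v ++ c :: w) = ∑ i ∈ Finset.range (u.length + 1),
      recSh k (u.take i) v * (MonoidAlgebra.single (FreeMonoid.ofList [c]) (1 : k) *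
        recSh k (u.drop i) w) := by
  intro u
  induction u with
  | nil =>
    intro v
    simp [recSh, MonoidAlgebra.single_mul_single]
  | cons a u ihu =>
    intro v
    induction v with
    | nil =>
      have := ihu []
      rw [List.length_cons, Finset.sum_range_succ']
      simp only [List.take_succ_cons, List.drop_succ_cons, List.take_zero, List.drop_zero,
        List.nil_append, recSh_nil] at this ⊢
      simp only [single_cons k a (List.take _ _), mul_assoc]
      rw [← Finset.mul_sum, ← this, recSh]
      congr 1
      rw [← mul_assoc, MonoidAlgebra.single_mul_single, ← FreeMonoid.ofList_append]
      simp
    | cons b v ihv =>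
      have := ihu (b :: v)
      rw [List.length_cons, Finset.sum_range_succ'] at ihv ⊢
      simp only [List.take_succ_cons, List.drop_succ_cons, List.take_zero, List.drop_zero,
        List.cons_append] at this ihv ⊢
      rw [recSh_cons, this, ihv]
      simp only [recSh, add_mul, Finset.sum_add_distrib, mul_add, Finset.mul_sum,
        single_cons k b v, mul_assoc, add_assoc]

theorem statement12 (u v w : List V) (hv : v ≠ []) (hw : w ≠ []) :
    succOp k u (v ++ w) =
      ∑ i ∈ Finset.range (u.length + 1),
        succOp k (u.take i) v * succOp k (u.drop i) w := by
  obtain ⟨b, v, rfl⟩ := List.exists_cons_of_ne_nil hv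
  obtain ⟨c, w, rfl⟩ := List.exists_cons_of_ne_nil hw
  simp only [List.cons_append, succOp_cons]
  rw [recSh_append, Finset.mul_sum]
  simp only [mul_assoc]
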